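/- Let n, L be positive integers, let c_1,…,c_L ∈ [0,1], and let v_1, w_1, …, v_L, w_L, v_{L+1} ∈ ℂ^n satisfy v_mᴴv_n = δ_{mn}, w_mᴴw_n = δ_{mn}, v_mᴴw_n = −δ_{mn}·i·c_m, and v_{L+1} of unit norm and ℂ-orthogonal to all v_k, w_k (k ≤ L). Let V = (v_1, w_1, …, v_L, w_L, v_{L+1}) ∈ ℂ^{n×(2L+1)}, let P > 0, set C = 2·Σ_{l=1}^{L} 1/√(1+c_l) + 1, and define M ∈ ℂ^{n×(L+1)} whose k-th column (k ≤ L) is √(P/C)·(v_k + i·w_k)/(1+c_k)^{3/4} and whose last column is √(P/C)·v_{L+1}. Then Tr(MMᴴ) = P, Re(Vᴴ M Mᴴ V) is invertible, and Tr[ (Re(Vᴴ M Mᴴ V))⁻¹ ] = (4/P)·( Σ_{k=1}^{L} 1/√(1+c_k) + 1/2 )². -/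

import Mathlib

open Matrix

/-- A sum over `Fin (2 * L + 1)`, grouped into consecutive pairs and the last term. -/
theorem Fin.sum_univ_pairs_add_last {A : Type*} [AddCommMonoid A] (L : ℕ)
    (f : Fin (2 * L + 1) → A) :
    ∑ j, f j = ∑ k : Fin L, (f ⟨2 * k, by omega⟩ + f ⟨2 * k + 1, by omega⟩) +
      f (Fin.last (2 * L)) := by
  rw [Fin.sum_univ_castSucc]
  congr 1
  have key : ∀ (L : ℕ) (g : Fin (2 * L) → A),
      ∑ j, g j = ∑ k : Fin L, (g ⟨2 * k, by omega⟩ + g ⟨2 * k + 1, by omega⟩) := by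
    intro L
    induction L with
    | zero => intro g; simp
    | succ L ih =>
      intro g
      refine (Fin.sum_univ_castSucc (n := 2 * L + 1) g).trans ?_
      rw [Fin.sum_univ_castSucc, Fin.sum_univ_castSucc, add_assoc]
      exact congrArg (· + _) (ih fun j => g ⟨j, by omega⟩)
  exact key L fun j => f j.castSucc

/-- An index in `Fin (2 * L + 1)` is the last one, or of the form `2 * k` or `2 * k + 1`. -/
theorem Fin.eq_last_or_eq_even_or_eq_odd {L : ℕ} (j : Fin (2 * L + 1)) :
    j = Fin.last (2 * L) ∨ (∃ k : Fin L, j = ⟨2 * k, by omega⟩) ∨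
      ∃ k : Fin L, j = ⟨2 * k + 1, by omega⟩ := by
  by_cases h : (j : ℕ) = 2 * L
  · exact Or.inl (Fin.ext h)
  · have hj : (j : ℕ) / 2 < L := by omega
    rcases Nat.mod_two_eq_zero_or_one j with h2 | h2
    · exact Or.inr (Or.inl ⟨⟨j / 2, hj⟩, Fin.ext (by simp only; omega)⟩)
    · exact Or.inr (Or.inr ⟨⟨j / 2, hj⟩, Fin.ext (by simp only; omega)⟩)

/-- Fractional powers of a positive real number, expressed through its fourth root. -/
theorem Real.exists_fourth_root {a : ℝ} (ha : 0 < a) :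
    ∃ r : ℝ, 0 < r ∧ a = r ^ 4 ∧ √a = r ^ 2 ∧ a ^ ((3 : ℝ) / 4) = r ^ 3 := by
  refine ⟨a ^ ((1 : ℝ) / 4), Real.rpow_pos_of_pos ha _, ?_, ?_, ?_⟩
  · rw [← Real.rpow_mul_natCast ha.le]; norm_num
  · rw [← Real.rpow_mul_natCast ha.le, Real.sqrt_eq_rpow]; norm_num
  · rw [← Real.rpow_mul_natCast ha.le]; norm_num

/-- A diagonal matrix with nonzero diagonal entries is invertible, and the trace of its inverse is
the sum of the inverse diagonal entries. -/
theorem Matrix.isUnit_and_trace_inv_diagonal {m : Type*} [Fintype m] [DecidableEq m]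
    {K : Type*} [Field K] {d : m → K} (hd : ∀ i, d i ≠ 0) :
    IsUnit (diagonal d) ∧ (diagonal d)⁻¹.trace = ∑ i, (d i)⁻¹ := by
  have h : diagonal d * diagonal (fun i => (d i)⁻¹) = 1 := by
    rw [diagonal_mul_diagonal, ← diagonal_one]
    congr 1
    funext i
    exact mul_inv_cancel₀ (hd i)
  exact ⟨(isUnit_iff_isUnit_det _).2 (isUnit_det_of_right_inverse h), by
    rw [inv_eq_right_inv h, trace_diagonal]⟩

/-- attainment part of Theorem 3, odd case `N_p = 2L+1`. With
`V = (v_1, w_1, …, v_L, w_L, v_{L+1})`, `C = 2·Σ_l 1/√(1+c_l) + 1`, and `M ∈ ℂ^{n×(L+1)}`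
whose `k`-th column (`k ≤ L`) is `√(P/C)·(v_k + i·w_k)/(1+c_k)^{3/4}` and whose last
column is `√(P/C)·v_{L+1}`, one has `Tr(MMᴴ) = P`, `Re(Vᴴ M Mᴴ V)` is invertible, and
`Tr[(Re(Vᴴ M Mᴴ V))⁻¹] = (4/P)·(Σ_k 1/√(1+c_k) + 1/2)²`. -/
theorem crb_attainment_odd {n L : ℕ} (hn : 0 < n) (hL : 0 < L)
    (v w : Fin L → (Fin n → ℂ)) (u : Fin n → ℂ) (c : Fin L → ℝ)
    (hc : ∀ k, 0 ≤ c k ∧ c k ≤ 1)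
    (hvv : ∀ k l, star (v k) ⬝ᵥ v l = if k = l then 1 else 0)
    (hww : ∀ k l, star (w k) ⬝ᵥ w l = if k = l then 1 else 0)
    (hvw : ∀ k l, star (v k) ⬝ᵥ w l = if k = l then -(Complex.I * (c k : ℂ)) else 0)
    (huu : star u ⬝ᵥ u = 1)
    (huv : ∀ k, star u ⬝ᵥ v k = 0)
    (huw : ∀ k, star u ⬝ᵥ w k = 0)
    (V : Matrix (Fin n) (Fin (2 * L + 1)) ℂ)
    (hV : V = Matrix.of fun (i : Fin n) (j : Fin (2 * L + 1)) =>
      if h : (j : ℕ) = 2 * L then u i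
      else if (j : ℕ) % 2 = 0 then v ⟨(j : ℕ) / 2, by have := j.isLt; omega⟩ i
      else w ⟨(j : ℕ) / 2, by have := j.isLt; omega⟩ i)
    (P : ℝ) (hP : 0 < P)
    (C : ℝ) (hC : C = 2 * ∑ l, 1 / Real.sqrt (1 + c l) + 1)
    (M : Matrix (Fin n) (Fin (L + 1)) ℂ)
    (hM : M = Matrix.of fun (i : Fin n) (k : Fin (L + 1)) =>
      if h : (k : ℕ) = L then ((Real.sqrt (P / C) : ℝ) : ℂ) * u i
      else ((Real.sqrt (P / C) /
          (1 + c ⟨(k : ℕ), by have := k.isLt; omega⟩) ^ ((3 : ℝ) / 4) : ℝ) : ℂ) *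
        (v ⟨(k : ℕ), by have := k.isLt; omega⟩ i +
          Complex.I * w ⟨(k : ℕ), by have := k.isLt; omega⟩ i)) :
    (M * Mᴴ).trace = (P : ℂ) ∧
    IsUnit ((Vᴴ * M * Mᴴ * V).map Complex.re) ∧
    (((Vᴴ * M * Mᴴ * V).map Complex.re)⁻¹).trace =
      (4 / P) * (∑ k, 1 / Real.sqrt (1 + c k) + 1 / 2) ^ 2 := by
  choose r hr0 hr4 hr2 hr3 using fun k => Real.exists_fourth_root (a := 1 + c k)
    (by linarith [(hc k).1])
  simp only [hr2] at hC ⊢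
  have hCpos : 0 < C := by
    rw [hC]
    have : 0 ≤ ∑ l, 1 / r l ^ 2 := Finset.sum_nonneg fun l _ => by positivity
    linarith
  set s := √(P / C) with hs
  have hs0 : 0 < s := Real.sqrt_pos.2 (by positivity)
  have hs2 : s ^ 2 = P / C := Real.sq_sqrt (by positivity)
  have hV0 : ∀ k : Fin L, (fun i => V i ⟨2 * k, by omega⟩) = v k := by
    intro k
    have h1 : (2 * (k : ℕ)) ≠ 2 * L := by omega
    funext i
    simp [hV, h1]
  have hV1 : ∀ k : Fin L, (fun i => V i ⟨2 * k + 1, by omega⟩) = w k := by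
    intro k
    have h1 : (2 * (k : ℕ) + 1) ≠ 2 * L := by omega
    have h2 : (2 * (k : ℕ) + 1) / 2 = k := by omega
    funext i
    simp [hV, h1, h2, Nat.add_mod]
  have hV2 : (fun i => V i (Fin.last (2 * L))) = u := by
    funext i
    simp [hV]
  have hM0 : ∀ k : Fin L, (fun i => M i k.castSucc) =
      ((s / r k ^ 3 : ℝ) : ℂ) • (v k + Complex.I • w k) := by
    intro k
    have h1 : (k : ℕ) ≠ L := by omega
    funext i
    simp [hM, h1, hr3]
  have hM1 : (fun i => M i (Fin.last L)) = (s : ℂ) • u := by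
    funext i
    simp [hM]
  have star_swap : ∀ a b : Fin n → ℂ, star a ⬝ᵥ b = star (star b ⬝ᵥ a) := by
    intro a b
    rw [star_dotProduct]
  have hwv : ∀ k l, star (w k) ⬝ᵥ v l = if k = l then Complex.I * (c k : ℂ) else 0 := by
    intro k l
    rw [star_swap, hvw]
    by_cases h : k = l
    · subst h; simp
    · simp [h, Ne.symm h]
  have hvu : ∀ k, star (v k) ⬝ᵥ u = 0 := fun k => by rw [star_swap, huv, star_zero]
  have hwu : ∀ k, star (w k) ⬝ᵥ u = 0 := fun k => by rw [star_swap, huw, star_zero]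
  have hr0' : ∀ k, (r k : ℂ) ≠ 0 := fun k => by exact_mod_cast (hr0 k).ne'
  have hc' : ∀ k, (c k : ℂ) = (r k : ℂ) ^ 4 - 1 := fun k => by
    rw [eq_sub_iff_add_eq']; exact_mod_cast hr4 k
  have hB : ∀ j k, (Vᴴ * M) j k = star (fun i => V i j) ⬝ᵥ fun i => M i k := fun j k => rfl
  have hG : ∀ k l, (Mᴴ * M) k l = star (fun i => M i k) ⬝ᵥ fun i => M i l := fun k l => rfl
  have hvM : ∀ k l : Fin L, star (v k) ⬝ᵥ (fun i => M i l.castSucc) =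
      if k = l then ((s * r k : ℝ) : ℂ) else 0 := by
    intro k l
    rw [hM0, dotProduct_smul, dotProduct_add, dotProduct_smul, hvv, hvw]
    by_cases h : k = l
    · subst h
      have := hr0' k
      simp only [if_true, smul_eq_mul, hc']
      push_cast
      field_simp
      linear_combination (s : ℂ) * (1 - (r k : ℂ) ^ 4) * Complex.I_sq
    · simp [h]
  have hwM : ∀ k l : Fin L, star (w k) ⬝ᵥ (fun i => M i l.castSucc) =
      if k = l then ((s * r k : ℝ) : ℂ) * Complex.I else 0 := by
    intro k l
    rw [hM0, dotProduct_smul, dotProduct_add, dotProduct_smul, hww, hwv]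
    by_cases h : k = l
    · subst h
      have := hr0' k
      simp only [if_true, smul_eq_mul, hc']
      push_cast
      field_simp
      ring
    · simp [h]
  have huM : ∀ l : Fin L, star u ⬝ᵥ (fun i => M i l.castSucc) = 0 := by
    intro l
    rw [hM0, dotProduct_smul, dotProduct_add, dotProduct_smul, huv, huw]
    simp
  refine ⟨?_, ?_⟩
  · have hdiag : ∀ k : Fin L, star (fun i => M i k.castSucc) ⬝ᵥ (fun i => M i k.castSucc) =
        ((s ^ 2 * (2 * (1 / r k ^ 2)) : ℝ) : ℂ) := by
      intro k
      nth_rw 1 [hM0]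
      have := hr0' k
      rw [star_smul, star_add, star_smul, smul_dotProduct, add_dotProduct, smul_dotProduct,
        hvM, hwM]
      simp only [if_true, smul_eq_mul, Complex.star_def, Complex.conj_ofReal, Complex.conj_I]
      push_cast
      field_simp
      linear_combination -(s : ℂ) ^ 2 * Complex.I_sq
    have hlast : star (fun i => M i (Fin.last L)) ⬝ᵥ (fun i => M i (Fin.last L)) =
        ((s ^ 2 : ℝ) : ℂ) := by
      rw [hM1, star_smul, smul_dotProduct, dotProduct_smul, huu]
      simp [sq]
    rw [trace_mul_comm, trace, Fin.sum_univ_castSucc]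
    simp only [diag_apply, hG, hdiag, hlast]
    rw [← Complex.ofReal_sum, ← Complex.ofReal_add, ← Finset.mul_sum, ← Finset.mul_sum]
    norm_cast
    rw [← mul_add_one, ← hC, hs2]
    field_simp
  · have hJ : (Vᴴ * M * Mᴴ * V).map Complex.re = diagonal fun j : Fin (2 * L + 1) =>
        if h : (j : ℕ) = 2 * L then s ^ 2 else s ^ 2 * r ⟨j / 2, by omega⟩ ^ 2 := by
      have hBB : Vᴴ * M * Mᴴ * V = (Vᴴ * M) * (Vᴴ * M)ᴴ := by
        rw [conjTranspose_mul, conjTranspose_conjTranspose, Matrix.mul_assoc (Vᴴ * M)]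
      have h1 : ∀ k : Fin L, 2 * (k : ℕ) ≠ 2 * L := fun k => by omega
      have h1' : ∀ k : Fin L, 2 * L ≠ 2 * (k : ℕ) := fun k => by omega
      have h2 : ∀ k : Fin L, 2 * (k : ℕ) + 1 ≠ 2 * L := fun k => by omega
      have h2' : ∀ k : Fin L, 2 * L ≠ 2 * (k : ℕ) + 1 := fun k => by omega
      have h3 : ∀ k : Fin L, (2 * (k : ℕ) + 1) / 2 = k := fun k => by omega
      have h4 : ∀ k l : Fin L, 2 * (k : ℕ) ≠ 2 * (l : ℕ) + 1 := fun k l => by omega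
      have h4' : ∀ k l : Fin L, 2 * (k : ℕ) + 1 ≠ 2 * (l : ℕ) := fun k l => by omega
      ext i j
      rw [hBB, map_apply, mul_apply, Fin.sum_univ_castSucc]
      simp only [conjTranspose_apply, hB]
      rcases Fin.eq_last_or_eq_even_or_eq_odd i with rfl | ⟨k, rfl⟩ | ⟨k, rfl⟩ <;>
      rcases Fin.eq_last_or_eq_even_or_eq_odd j with rfl | ⟨l, rfl⟩ | ⟨l, rfl⟩ <;>
      simp only [hV0, hV1, hV2, hvM, hwM, huM, hM1, dotProduct_smul, huu, hvu, hwu,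
        ite_mul, zero_mul, Finset.sum_ite_eq, Finset.mem_univ, if_true] <;>
      simp only [diagonal_apply, Fin.ext_iff, Fin.val_last, h1, h1', h2, h2', h3, h4, h4',
        dite_true, dite_false, if_true, if_false, star_zero, mul_zero, zero_mul,
        Finset.sum_const_zero,
        smul_eq_mul, mul_one, add_zero, zero_add, Fin.eta, Nat.mul_div_cancel_left _ two_pos,
        Nat.mul_right_inj two_ne_zero, Nat.add_right_cancel_iff, Complex.zero_re]
      · simp [sq]
      all_goals by_cases h : (k : ℕ) = l
      all_goals first
        | simp [h, Ne.symm h]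
        | obtain rfl := Fin.ext h; simp; try ring
    rw [hJ]
    have hd : ∀ j : Fin (2 * L + 1),
        (if h : (j : ℕ) = 2 * L then s ^ 2 else s ^ 2 * r ⟨j / 2, by omega⟩ ^ 2) ≠ 0 := by
      intro j
      split_ifs
      · positivity
      · have := hr0 ⟨j / 2, by omega⟩
        positivity
    obtain ⟨hunit, htr⟩ := isUnit_and_trace_inv_diagonal hd
    refine ⟨hunit, ?_⟩
    rw [htr, Fin.sum_univ_pairs_add_last]
    have h1 : ∀ k : Fin L, 2 * (k : ℕ) ≠ 2 * L := fun k => by omega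
    have h2 : ∀ k : Fin L, 2 * (k : ℕ) + 1 ≠ 2 * L := fun k => by omega
    have h3 : ∀ k : Fin L, (2 * (k : ℕ) + 1) / 2 = k := fun k => by omega
    simp only [h1, h2, h3, dite_false, Fin.val_last, dite_true, Nat.mul_div_cancel_left _ two_pos,
      Fin.eta]
    have h4 : ∑ k, ((s ^ 2 * r k ^ 2)⁻¹ + (s ^ 2 * r k ^ 2)⁻¹) =
        (s ^ 2)⁻¹ * (2 * ∑ k, 1 / r k ^ 2) := by
      rw [Finset.mul_sum, Finset.mul_sum]
      refine Finset.sum_congr rfl fun k _ => ?_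
      rw [mul_inv, one_div]
      ring
    have h5 : ∑ k, 1 / r k ^ 2 + 1 / 2 = C / 2 := by rw [hC]; ring
    rw [h4, ← mul_add_one, ← hC, hs2, h5]
    field_simp
    ring
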